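/- Convergence of geodesics under landscape convergence: Let f_n be a sequence of landscapes converging uniformly on compact subsets of ℝ⁴↑ to a proper landscape f. Fix (x,t;y,s) ∈ ℝ⁴↑ and suppose there is a unique geodesic π from (x,t) to (y,s) in f. Suppose also that for all sufficiently large n there exist geodesics π_n from (x,t) to (y,s) in f_n. Then π_n converges uniformly to π on [t,s]. -/

import Mathlib

/-- The parameter space `ℝ⁴↑ = {(x, s, y, t) : s < t}` of pairs of space-time points. -/
def R4up : Set (ℝ × ℝ × ℝ × ℝ) := {p | p.2.1 < p.2.2.2}

/-- `f` is a landscape: it satisfies the metric composition law, with the maximum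
attained. Here `f (x, s, y, t)` is read as `f(x, s; y, t)` for `s < t`. -/
def IsLandscape (f : ℝ × ℝ × ℝ × ℝ → ℝ) : Prop :=
  ∀ x y s r t : ℝ, s < r → r < t →
    IsGreatest (Set.range fun z => f (x, s, z, r) + f (z, r, y, t)) (f (x, s, y, t))

/-- `f` is a proper landscape: a continuous landscape with uniformly parabolic
behaviour on bounded sets, compactly supported maximizers, and satisfying the
quadrangle inequality. -/
def IsProperLandscape (f : ℝ × ℝ × ℝ × ℝ → ℝ) : Prop :=
  IsLandscape f ∧
  ContinuousOn f R4up ∧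
  (∀ b : ℝ, 0 < b → ∃ c : ℝ, ∀ x t y s : ℝ, 0 < s →
    |x| ≤ b → |t| ≤ b → |y| ≤ b → |t + s| ≤ b →
    |f (x, t, y, t + s) + (x - y) ^ 2 / s| ≤ c) ∧
  (∀ K : Set (ℝ × ℝ × ℝ × ℝ), K ⊆ R4up → IsCompact K →
    ∃ bK : ℝ, 0 < bK ∧ ∀ x r y t : ℝ, (x, r, y, t) ∈ K → ∀ s ∈ Set.Ioo r t, ∀ z : ℝ,
      (∀ w : ℝ, f (x, r, w, s) + f (w, s, y, t) ≤ f (x, r, z, s) + f (z, s, y, t)) →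
      |z| ≤ bK) ∧
  (∀ x x' y y' r t : ℝ, r < t → x ≤ x' → y ≤ y' →
    f (x, r, y', t) + f (x', r, y, t) ≤ f (x, r, y, t) + f (x', r, y', t))

/-- The length `∫ df ∘ π` of a path `π : [t, s] → ℝ` with respect to a landscape `f`:
the infimum over partitions `t = t₀ < t₁ < … < t_k = s` of the sum of the increments
of `f` along the path. -/
noncomputable def pathLength (f : ℝ × ℝ × ℝ × ℝ → ℝ) (π : ℝ → ℝ) (t s : ℝ) : ℝ :=
  sInf { v : ℝ | ∃ (k : ℕ) (σ : ℕ → ℝ), 0 < k ∧ σ 0 = t ∧ σ k = s ∧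
    (∀ i < k, σ i < σ (i + 1)) ∧
    v = ∑ i ∈ Finset.range k, f (π (σ i), σ i, π (σ (i + 1)), σ (i + 1)) }

/-- `π` is a geodesic from `(π t, t)` to `(π s, s)` in the landscape `f`: a continuous
path on `[t, s]` whose length equals `f (π t, t, π s, s)`. -/
def IsGeodesic (f : ℝ × ℝ × ℝ × ℝ → ℝ) (π : ℝ → ℝ) (t s : ℝ) : Prop :=
  ContinuousOn π (Set.Icc t s) ∧ pathLength f π t s = f (π t, t, π s, s)

open Filter Topology

/-- `f` is additive along `π` on `[t, s]`: the increments over every partition add up to the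
value of `f` between the end points. -/
def IsAdditiveAlong (f : ℝ × ℝ × ℝ × ℝ → ℝ) (π : ℝ → ℝ) (t s : ℝ) : Prop :=
  ∀ (k : ℕ) (σ : ℕ → ℝ), 0 < k → σ 0 = t → σ k = s → (∀ i < k, σ i < σ (i + 1)) →
    ∑ i ∈ Finset.range k, f (π (σ i), σ i, π (σ (i + 1)), σ (i + 1)) = f (π t, t, π s, s)

/-- Continuous convergence of `F` to `f` on `ℝ⁴↑` along the filter `l`. -/
def ConvergesContinuously (F : ℕ → ℝ × ℝ × ℝ × ℝ → ℝ) (f : ℝ × ℝ × ℝ × ℝ → ℝ)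
    (l : Filter ℕ) : Prop :=
  ∀ (a u b v : ℕ → ℝ) (x t y s : ℝ), t < s → Tendsto a l (𝓝 x) → Tendsto u l (𝓝 t) →
    Tendsto b l (𝓝 y) → Tendsto v l (𝓝 s) →
    Tendsto (fun n => F n (a n, u n, b n, v n)) l (𝓝 (f (x, t, y, s)))

theorem isOpen_R4up : IsOpen R4up := by
  unfold R4up
  exact isOpen_lt (by fun_prop) (by fun_prop)

theorem convergesContinuously_of_tendstoUniformlyOn {F : ℕ → ℝ × ℝ × ℝ × ℝ → ℝ}
    {f : ℝ × ℝ × ℝ × ℝ → ℝ} {l : Filter ℕ} (hf : ContinuousOn f R4up) (hl : l ≤ atTop)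
    (hconv : ∀ K : Set (ℝ × ℝ × ℝ × ℝ), K ⊆ R4up → IsCompact K →
      TendstoUniformlyOn F f atTop K) :
    ConvergesContinuously F f l := by
  intro a u b v x t y s hts ha hu hb hv
  have hmem : (x, t, y, s) ∈ R4up := hts
  have hloc : TendstoLocallyUniformlyOn F f l R4up := by
    rw [tendstoLocallyUniformlyOn_iff_forall_isCompact isOpen_R4up]
    exact fun K hK hKc V hV => hl (hconv K hK hKc V hV)
  refine hloc.tendsto_comp (hf _ hmem) hmem ?_
  rw [isOpen_R4up.nhdsWithin_eq hmem]
  exact ha.prodMk_nhds (hu.prodMk_nhds (hb.prodMk_nhds hv))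

namespace IsLandscape

theorem add_le {f : ℝ × ℝ × ℝ × ℝ → ℝ} (hf : IsLandscape f) {s r t : ℝ} (hsr : s < r)
    (hrt : r < t) (x z y : ℝ) : f (x, s, z, r) + f (z, r, y, t) ≤ f (x, s, y, t) :=
  (hf x y s r t hsr hrt).2 ⟨z, rfl⟩

theorem sum_le {f : ℝ × ℝ × ℝ × ℝ → ℝ} (hf : IsLandscape f) (π : ℝ → ℝ) (σ : ℕ → ℝ) (k : ℕ)
    (hσ : ∀ i < k + 1, σ i < σ (i + 1)) :
    σ 0 < σ (k + 1) ∧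
    ∑ i ∈ Finset.range (k + 1), f (π (σ i), σ i, π (σ (i + 1)), σ (i + 1)) ≤
      f (π (σ 0), σ 0, π (σ (k + 1)), σ (k + 1)) := by
  induction k with
  | zero => simpa using hσ
  | succ k ih =>
    obtain ⟨h0, h1⟩ := ih fun i hi => hσ i (by omega)
    have h2 := hσ (k + 1) (by omega)
    refine ⟨h0.trans h2, ?_⟩
    rw [Finset.sum_range_succ]
    linarith [hf.add_le h0 h2 (π (σ 0)) (π (σ (k + 1))) (π (σ (k + 1 + 1)))]

end IsLandscape

/-- A path whose length is nonzero is a geodesic only if `f` is additive along it: the infimum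
defining its length is then taken over a set bounded below. -/
theorem IsGeodesic.isAdditiveAlong {f : ℝ × ℝ × ℝ × ℝ → ℝ} {π : ℝ → ℝ} {t s : ℝ}
    (h : IsGeodesic f π t s) (hf : IsLandscape f) (hne : f (π t, t, π s, s) ≠ 0) :
    IsAdditiveAlong f π t s := by
  intro k σ hk h0 hks hσ
  apply le_antisymm
  · obtain ⟨k, rfl⟩ := Nat.exists_eq_succ_of_ne_zero hk.ne'
    have := (hf.sum_le π σ k hσ).2
    rwa [h0, hks] at this
  · have hl := h.2
    rw [pathLength] at hl
    rw [← hl]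
    refine csInf_le ?_ ⟨k, σ, hk, h0, hks, hσ, rfl⟩
    by_contra hb
    exact hne (hl.symm.trans (Real.sInf_of_not_bddBelow hb))

namespace IsAdditiveAlong

variable {f : ℝ × ℝ × ℝ × ℝ → ℝ} {π : ℝ → ℝ} {t s : ℝ}

theorem isGeodesic (h : IsAdditiveAlong f π t s) (hts : t < s)
    (hc : ContinuousOn π (Set.Icc t s)) : IsGeodesic f π t s := by
  refine ⟨hc, ?_⟩
  rw [pathLength]
  refine (congrArg sInf (Set.ext fun v => ?_)).trans (csInf_singleton (f (π t, t, π s, s)))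
  constructor
  · rintro ⟨k, σ, hk, h0, hks, hσ, rfl⟩
    exact h k σ hk h0 hks hσ
  · rintro rfl
    exact ⟨1, fun i => if i = 0 then t else s, one_pos, by simp, by simp, by simpa using hts,
      by simp⟩

theorem add_eq (h : IsAdditiveAlong f π t s) {r : ℝ} (htr : t < r) (hrs : r < s) :
    f (π t, t, π r, r) + f (π r, r, π s, s) = f (π t, t, π s, s) := by
  have := h 2 (fun i => if i = 0 then t else if i = 1 then r else s) two_pos (by simp) (by simp)
    (by intro i hi; interval_cases i <;> simpa)
  simpa [Finset.sum_range_succ] using this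

theorem add_add_eq (h : IsAdditiveAlong f π t s) {r r' : ℝ} (htr : t < r) (hrr : r < r')
    (hrs : r' < s) :
    f (π t, t, π r, r) + f (π r, r, π r', r') + f (π r', r', π s, s) = f (π t, t, π s, s) := by
  have := h 3 (fun i => if i = 0 then t else if i = 1 then r else if i = 2 then r' else s)
    three_pos (by simp) (by simp) (by intro i hi; interval_cases i <;> simpa)
  simpa [Finset.sum_range_succ] using this

end IsAdditiveAlong

namespace IsProperLandscape

variable {f : ℝ × ℝ × ℝ × ℝ → ℝ}

theorem exists_abs_le (hf : IsProperLandscape f) {b : ℝ} (hb : 0 < b) :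
    ∃ c : ℝ, 0 ≤ c ∧ ∀ x t y s : ℝ, t < s → |x| ≤ b → |t| ≤ b → |y| ≤ b → |s| ≤ b →
      |f (x, t, y, s) + (x - y) ^ 2 / (s - t)| ≤ c := by
  obtain ⟨c, hc⟩ := hf.2.2.1 b hb
  refine ⟨max c 0, le_max_right _ _, fun x t y s hts hx ht hy hs => ?_⟩
  have := hc x t y (s - t) (sub_pos.2 hts) hx ht hy (by simpa using hs)
  rw [add_sub_cancel] at this
  exact this.trans (le_max_left _ _)

/-- The path from `(x, t)` to `(y, s)` that starts like `r ↦ x + m (s - t) (r - t) ^ (1 / 4)`. -/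
noncomputable def steepPath (x t y s m : ℝ) (r : ℝ) : ℝ :=
  x + (y - x) * (r - t) / (s - t) + m * √√(r - t) * (s - r)

theorem continuous_steepPath (x t y s m : ℝ) : Continuous (steepPath x t y s m) := by
  unfold steepPath
  fun_prop

theorem steepPath_left (x t y s m : ℝ) : steepPath x t y s m t = x := by
  simp [steepPath]

theorem steepPath_right (x t y s m : ℝ) (hts : t < s) : steepPath x t y s m s = y := by
  have : s - t ≠ 0 := (sub_pos.2 hts).ne'
  simp [steepPath, this]

theorem tendsto_steepPath_increment (x t y s m : ℝ) (hts : t < s) (hm : 0 < m) :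
    Tendsto (fun u : ℝ => (x - steepPath x t y s m (t + u ^ 4)) ^ 2 / u ^ 4) (𝓝[>] 0) atTop := by
  have hL := sub_pos.2 hts
  have h1 : Tendsto (fun u : ℝ => ((y - x) * u ^ 3 / (s - t) + m * (s - t - u ^ 4)) ^ 2)
      (𝓝[>] 0) (𝓝 ((m * (s - t)) ^ 2)) := by
    apply Tendsto.mono_left _ nhdsWithin_le_nhds
    have : Continuous (fun u : ℝ => ((y - x) * u ^ 3 / (s - t) + m * (s - t - u ^ 4)) ^ 2) := by
      fun_prop
    simpa using this.tendsto 0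
  have h2 : Tendsto (fun u : ℝ => (u⁻¹) ^ 2) (𝓝[>] 0) atTop :=
    (tendsto_pow_atTop two_ne_zero).comp tendsto_inv_nhdsGT_zero
  refine (h1.pos_mul_atTop (by positivity) h2).congr' ?_
  filter_upwards [self_mem_nhdsWithin] with u hu
  have hu : 0 < u := hu
  have hs : √√(t + u ^ 4 - t) = u := by
    rw [add_sub_cancel_left, show u ^ 4 = (u ^ 2) ^ 2 by ring, Real.sqrt_sq (by positivity),
      Real.sqrt_sq hu.le]
  rw [steepPath, hs]
  field_simp
  ring

/-- The length of `steepPath` is an infimum over a set that is not bounded below. -/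
theorem pathLength_steepPath (hf : IsProperLandscape f) (x t y s m : ℝ) (hts : t < s)
    (hm : 0 < m) : pathLength f (steepPath x t y s m) t s = 0 := by
  apply Real.sInf_of_not_bddBelow
  rintro ⟨B, hB⟩
  set τ := steepPath x t y s m
  obtain ⟨C, hC⟩ := isCompact_Icc.exists_bound_of_continuousOn (s := Set.Icc t s)
    (continuous_steepPath x t y s m).continuousOn
  obtain ⟨b, hCb, hb0, hbpos⟩ : ∃ b, C ≤ b ∧ max |t| |s| ≤ b ∧ 0 < b :=
    ⟨max C (max |t| |s|) + 1, (le_max_left _ _).trans (le_add_of_nonneg_right zero_le_one),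
      (le_max_right _ _).trans (le_add_of_nonneg_right zero_le_one), by positivity⟩
  have ht : |t| ≤ b := (le_max_left _ _).trans hb0
  have hs : |s| ≤ b := (le_max_right _ _).trans hb0
  have hτb : ∀ r ∈ Set.Icc t s, |τ r| ≤ b := fun r hr =>
    (hC r hr).trans hCb
  obtain ⟨c, hc0, hc⟩ := hf.exists_abs_le hbpos
  have hsmall : ∀ᶠ u : ℝ in 𝓝[>] 0, t + u ^ 4 < s := by
    have : Continuous fun u : ℝ => t + u ^ 4 := by fun_prop
    exact nhdsWithin_le_nhds (this.tendsto 0 (Iio_mem_nhds (by simpa using hts)))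
  obtain ⟨u, hu0, hus, hbig⟩ := (eventually_mem_nhdsWithin.and (hsmall.and
    ((tendsto_steepPath_increment x t y s m hts hm).eventually_gt_atTop (2 * c - B)))).exists
  have hu0 : 0 < u := hu0
  set r := t + u ^ 4 with hr
  have htr : t < r := by rw [hr]; linarith [pow_pos hu0 4]
  have hrb : |r| ≤ b := by
    rw [abs_le] at *
    constructor <;> linarith [ht.1, hs.2]
  have hsum := hB ⟨2, fun i => if i = 0 then t else if i = 1 then r else s, two_pos, by simp,
    by simp, by intro i hi; interval_cases i <;> simpa, rfl⟩
  simp only [Finset.sum_range_succ] at hsum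
  simp at hsum
  have h1 := hc (τ t) t (τ r) r htr (hτb _ ⟨le_rfl, hts.le⟩) ht (hτb _ ⟨htr.le, hus.le⟩) hrb
  have h2 := hc (τ r) r (τ s) s hus (hτb _ ⟨htr.le, hus.le⟩) hrb (hτb _ ⟨hts.le, le_rfl⟩) hs
  have h3 : 0 ≤ (τ r - τ s) ^ 2 / (s - r) := div_nonneg (sq_nonneg _) (by linarith)
  have h4 : r - t = u ^ 4 := by rw [hr]; ring
  have h5 : τ t = x := steepPath_left x t y s m
  rw [h4, h5] at h1
  rw [h5] at hsum
  linarith [(abs_le.1 h1).2, (abs_le.1 h2).2]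

/-- If the geodesic from `(x, t)` to `(y, s)` is unique, then `f (x, t, y, s) ≠ 0`: otherwise
every path of infinite energy would count as a geodesic. -/
theorem ne_zero_of_unique (hf : IsProperLandscape f) {x t y s : ℝ} (hts : t < s) {π : ℝ → ℝ}
    (huniq : ∀ τ : ℝ → ℝ, IsGeodesic f τ t s → τ t = x → τ s = y →
      Set.EqOn τ π (Set.Icc t s)) : f (x, t, y, s) ≠ 0 := by
  intro h0
  have key : ∀ m : ℝ, 0 < m → Set.EqOn (steepPath x t y s m) π (Set.Icc t s) := fun m hm =>
    huniq _ ⟨(continuous_steepPath x t y s m).continuousOn, by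
      rw [hf.pathLength_steepPath x t y s m hts hm, steepPath_left, steepPath_right _ _ _ _ _ hts,
        h0]⟩ (steepPath_left x t y s m) (steepPath_right x t y s m hts)
  have hmid : (t + s) / 2 ∈ Set.Icc t s := ⟨by linarith, by linarith⟩
  have h := (key 1 one_pos hmid).trans (key 2 two_pos hmid).symm
  have hpos : 0 < √√((t + s) / 2 - t) * (s - (t + s) / 2) :=
    mul_pos (Real.sqrt_pos.2 (Real.sqrt_pos.2 (by linarith))) (by linarith)
  simp only [steepPath] at h
  linarith

end IsProperLandscape

/-- A bounded path along which a proper landscape is additive is continuous. -/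
theorem IsAdditiveAlong.continuousOn {f : ℝ × ℝ × ℝ × ℝ → ℝ} {τ : ℝ → ℝ} {t s B : ℝ}
    (h : IsAdditiveAlong f τ t s) (hf : IsProperLandscape f)
    (hB : ∀ r ∈ Set.Icc t s, |τ r| ≤ B) : ContinuousOn τ (Set.Icc t s) := by
  obtain ⟨b, hBb, hb0, hbpos⟩ : ∃ b, B ≤ b ∧ max |t| |s| ≤ b ∧ 0 < b :=
    ⟨max B (max |t| |s|) + 1, (le_max_left _ _).trans (le_add_of_nonneg_right zero_le_one),
      (le_max_right _ _).trans (le_add_of_nonneg_right zero_le_one), by positivity⟩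
  have ht : |t| ≤ b := (le_max_left _ _).trans hb0
  have hs : |s| ≤ b := (le_max_right _ _).trans hb0
  obtain ⟨c, hc0, hc⟩ := hf.exists_abs_le hbpos
  have hc' : ∀ r r', t ≤ r → r < r' → r' ≤ s →
      f (τ r, r, τ r', r') + (τ r - τ r') ^ 2 / (r' - r) ≤ c := fun r r' h1 h2 h3 => by
    have hr : |r| ≤ b := by rw [abs_le] at *; constructor <;> linarith [ht.1, hs.2]
    have hr' : |r'| ≤ b := by rw [abs_le] at *; constructor <;> linarith [ht.1, hs.2]
    exact (abs_le.1 (hc _ _ _ _ h2 ((hB r ⟨h1, h2.le.trans h3⟩).trans hBb) hr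
      ((hB r' ⟨h1.trans h2.le, h3⟩).trans hBb) hr')).2
  have hle : ∀ r r', t ≤ r → r < r' → r' ≤ s → f (τ r, r, τ r', r') ≤ c :=
    fun r r' h1 h2 h3 => by
      have := div_nonneg (sq_nonneg (τ r - τ r')) (sub_pos.2 h2).le
      linarith [hc' r r' h1 h2 h3]
  set D := 3 * c - f (τ t, t, τ s, s)
  have hinc : ∀ r r', t ≤ r → r < r' → r' ≤ s → (τ r - τ r') ^ 2 ≤ D * (r' - r) :=
    fun r r' h1 h2 h3 => by
      rw [← div_le_iff₀ (sub_pos.2 h2)]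
      have h4 := hc' r r' h1 h2 h3
      rcases h1.eq_or_lt with rfl | h1'
      · rcases h3.eq_or_lt with rfl | h3'
        · linarith
        · linarith [h.add_eq h2 h3', hle r' s h2.le h3' le_rfl]
      · rcases h3.eq_or_lt with rfl | h3'
        · linarith [h.add_eq h1' h2, hle t r le_rfl h1' h2.le]
        · linarith [h.add_add_eq h1' h2 h3', hle t r le_rfl h1' (h2.le.trans h3),
            hle r' s (h1.trans h2.le) h3' le_rfl]
  have hdist : ∀ r ∈ Set.Icc t s, ∀ r' ∈ Set.Icc t s, dist (τ r') (τ r) ≤ √(D * |r' - r|) := by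
    intro r hr r' hr'
    rw [Real.dist_eq]
    apply Real.abs_le_sqrt
    rcases lt_trichotomy r r' with h1 | rfl | h1
    · rw [abs_of_pos (sub_pos.2 h1)]
      linarith [hinc r r' hr.1 h1 hr'.2, sub_sq_comm (τ r) (τ r')]
    · simp
    · rw [abs_of_neg (sub_neg.2 h1), neg_sub]
      exact hinc r' r hr'.1 h1 hr.2
  intro r hr
  rw [ContinuousWithinAt, tendsto_iff_dist_tendsto_zero]
  refine squeeze_zero' (Eventually.of_forall fun _ => dist_nonneg)
    (eventually_nhdsWithin_of_forall (hdist r hr)) ?_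
  have : Continuous fun r' : ℝ => √(D * |r' - r|) := by fun_prop
  simpa using (this.tendsto r).mono_left nhdsWithin_le_nhds

section Limits

variable {F : ℕ → ℝ × ℝ × ℝ × ℝ → ℝ} {P : ℕ → ℝ → ℝ}
  {f : ℝ × ℝ × ℝ × ℝ → ℝ} {l : Filter ℕ} {x t y s : ℝ}

/-- Under convergence to a proper landscape, the weights between two points that approach distinct
points at the same time tend to `-∞`. -/
theorem ConvergesContinuously.eventually_lt (hlim : ConvergesContinuously F f l)
    (hF : ∀ n, IsLandscape (F n)) (hf : IsProperLandscape f) {a u b v : ℕ → ℝ} {z w r : ℝ}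
    (ha : Tendsto a l (𝓝 z)) (hu : Tendsto u l (𝓝 r)) (hb : Tendsto b l (𝓝 w))
    (hv : Tendsto v l (𝓝 r)) (huv : ∀ᶠ n in l, u n < v n) (hzw : z ≠ w) (C : ℝ) :
    ∀ᶠ n in l, F n (a n, u n, b n, v n) < C := by
  obtain ⟨M, hz, hw, hr⟩ : ∃ M, |z| ≤ M ∧ |w| ≤ M ∧ |r| + 1 ≤ M :=
    ⟨max |z| (max |w| (|r| + 1)), le_max_left _ _, (le_max_left _ _).trans (le_max_right _ _),
      (le_max_right _ _).trans (le_max_right _ _)⟩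
  obtain ⟨c, hc0, hc⟩ := hf.exists_abs_le (b := M) (by linarith [abs_nonneg r])
  have hd : 0 < (z - w) ^ 2 := sq_pos_of_ne_zero (sub_ne_zero.2 hzw)
  have hK : 0 < 2 * c + |C| + 1 := by positivity
  obtain ⟨e, he0, he1, heK⟩ : ∃ e : ℝ, 0 < e ∧ e ≤ 1 ∧ 2 * c + |C| + 1 ≤ (z - w) ^ 2 / e := by
    refine ⟨min 1 ((z - w) ^ 2 / (2 * c + |C| + 1)), by positivity, min_le_left _ _, ?_⟩
    rw [le_div_comm₀ hK (by positivity)]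
    exact min_le_right _ _
  have hr1 : |r| ≤ M := by linarith
  have hr2 : |r - e| ≤ M := by
    have := abs_sub r e
    rw [abs_of_pos he0] at this
    linarith
  have hre : r - e < r := by linarith
  have h1 := (abs_le.1 (hc z (r - e) w r hre hz hr2 hw hr1)).2
  have h2 := (abs_le.1 (hc z (r - e) z r hre hz hr2 hz hr1)).1
  simp only [sub_sub_cancel, sub_self, ne_eq, OfNat.ofNat_ne_zero, not_false_eq_true, zero_pow,
    zero_div, add_zero] at h1 h2
  have hlt : f (z, r - e, w, r) - f (z, r - e, z, r) < C := by linarith [neg_abs_le C]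
  have hT := (hlim _ _ b v z (r - e) w r hre tendsto_const_nhds tendsto_const_nhds hb hv).sub
    (hlim _ _ a u z (r - e) z r hre tendsto_const_nhds tendsto_const_nhds ha hu)
  filter_upwards [hT.eventually_lt_const hlt, huv, hu.eventually_const_lt hre] with n h3 h4 h5
  linarith [(hF n).add_le h5 h4 z (a n) (b n)]

theorem ConvergesContinuously.eq_left [l.NeBot] (hlim : ConvergesContinuously F f l)
    (hF : ∀ n, IsLandscape (F n)) (hf : IsProperLandscape f) (hts : t < s)
    (hP : ∀ᶠ n in l, IsAdditiveAlong (F n) (P n) t s ∧ P n t = x ∧ P n s = y) {ρ : ℕ → ℝ} {z : ℝ}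
    (hρ : ∀ n, ρ n ∈ Set.Icc t s) (hρt : Tendsto ρ l (𝓝 t))
    (hz : Tendsto (fun n => P n (ρ n)) l (𝓝 z)) : z = x := by
  by_contra hne
  have hgt : ∀ᶠ n in l, t < ρ n := by
    filter_upwards [hz.eventually_ne hne, hP] with n h1 h2
    refine (hρ n).1.lt_of_ne fun h => h1 ?_
    rw [← h, h2.2.1]
  have hT := (hlim _ _ _ _ x t y s hts tendsto_const_nhds tendsto_const_nhds tendsto_const_nhds
    tendsto_const_nhds).sub (hlim _ _ _ _ z t y s hts hz hρt tendsto_const_nhds tendsto_const_nhds)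
  obtain ⟨n, h1, h2, h3, h4, h5⟩ := ((hlim.eventually_lt hF hf tendsto_const_nhds
    tendsto_const_nhds hz hρt hgt (Ne.symm hne) (f (x, t, y, s) - f (z, t, y, s) - 1)).and
    ((hT.eventually_const_lt (sub_one_lt _)).and
    (hgt.and ((hρt.eventually_lt_const hts).and hP)))).exists
  have := h5.1.add_eq h3 h4
  rw [h5.2.1, h5.2.2] at this
  linarith

theorem ConvergesContinuously.eq_right [l.NeBot] (hlim : ConvergesContinuously F f l)
    (hF : ∀ n, IsLandscape (F n)) (hf : IsProperLandscape f) (hts : t < s)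
    (hP : ∀ᶠ n in l, IsAdditiveAlong (F n) (P n) t s ∧ P n t = x ∧ P n s = y) {ρ : ℕ → ℝ} {z : ℝ}
    (hρ : ∀ n, ρ n ∈ Set.Icc t s) (hρs : Tendsto ρ l (𝓝 s))
    (hz : Tendsto (fun n => P n (ρ n)) l (𝓝 z)) : z = y := by
  by_contra hne
  have hlt : ∀ᶠ n in l, ρ n < s := by
    filter_upwards [hz.eventually_ne hne, hP] with n h1 h2
    refine (hρ n).2.lt_of_ne fun h => h1 ?_
    rw [h, h2.2.2]
  have hT := (hlim _ _ _ _ x t y s hts tendsto_const_nhds tendsto_const_nhds tendsto_const_nhds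
    tendsto_const_nhds).sub (hlim _ _ _ _ x t z s hts tendsto_const_nhds tendsto_const_nhds hz hρs)
  obtain ⟨n, h1, h2, h3, h4, h5⟩ := ((hlim.eventually_lt hF hf hz hρs tendsto_const_nhds
    tendsto_const_nhds hlt hne (f (x, t, y, s) - f (x, t, z, s) - 1)).and
    ((hT.eventually_const_lt (sub_one_lt _)).and
    (hlt.and ((hρs.eventually_const_lt hts).and hP)))).exists
  have := h5.1.add_eq h4 h3
  rw [h5.2.1, h5.2.2] at this
  linarith

theorem ConvergesContinuously.add_eq [l.NeBot] (hlim : ConvergesContinuously F f l)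
    (hP : ∀ᶠ n in l, IsAdditiveAlong (F n) (P n) t s ∧ P n t = x ∧ P n s = y) {ρ : ℕ → ℝ}
    {r z : ℝ} (htr : t < r) (hrs : r < s) (hρ : Tendsto ρ l (𝓝 r))
    (hz : Tendsto (fun n => P n (ρ n)) l (𝓝 z)) :
    f (x, t, z, r) + f (z, r, y, s) = f (x, t, y, s) := by
  have h1 := (hlim _ _ _ _ x t z r htr tendsto_const_nhds tendsto_const_nhds hz hρ).add
    (hlim _ _ _ _ z r y s hrs hz hρ tendsto_const_nhds tendsto_const_nhds)
  have h2 := hlim _ _ _ _ x t y s (htr.trans hrs) tendsto_const_nhds tendsto_const_nhds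
    tendsto_const_nhds tendsto_const_nhds
  refine tendsto_nhds_unique (h1.congr' ?_) h2
  filter_upwards [hP, hρ.eventually_const_lt htr, hρ.eventually_lt_const hrs] with n h3 h4 h5
  have := h3.1.add_eq h4 h5
  rwa [h3.2.1, h3.2.2] at this

theorem Ultrafilter.exists_tendsto_of_isCompact (U : Ultrafilter ℕ) {K : Set ℝ} (hK : IsCompact K)
    {g : ℕ → ℝ} (hg : ∀ᶠ n in U, g n ∈ K) : ∃ z ∈ K, Tendsto g U (𝓝 z) :=
  hK.ultrafilter_le_nhds (U.map g) (le_principal_iff.2 hg)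

/-- Geodesics of landscapes converging to a proper landscape are eventually bounded. -/
theorem ConvergesContinuously.exists_bound {U : Ultrafilter ℕ}
    (hlim : ConvergesContinuously F f U) (hF : ∀ n, IsLandscape (F n))
    (hf : IsProperLandscape f) (hts : t < s)
    (hP : ∀ᶠ n in U, IsAdditiveAlong (F n) (P n) t s ∧ P n t = x ∧ P n s = y)
    (hcont : ∀ᶠ n in U, ContinuousOn (P n) (Set.Icc t s)) :
    ∃ B, ∀ ρ : ℕ → ℝ, (∀ n, ρ n ∈ Set.Icc t s) → ∀ᶠ n in U, |P n (ρ n)| ≤ B := by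
  obtain ⟨b, -, hb⟩ := hf.2.2.2.1 {(x, t, y, s)} (by simpa [R4up] using hts) isCompact_singleton
  obtain ⟨B, hbB, hxB, hyB⟩ : ∃ B, b < B ∧ |x| < B ∧ |y| < B :=
    ⟨max b (max |x| |y|) + 1, lt_add_of_le_of_pos (le_max_left _ _) one_pos,
      lt_add_of_le_of_pos ((le_max_left _ _).trans (le_max_right _ _)) one_pos,
      lt_add_of_le_of_pos ((le_max_right _ _).trans (le_max_right _ _)) one_pos⟩
  refine ⟨B, fun ρ hρ => ?_⟩
  by_contra hnot
  rw [← Ultrafilter.eventually_not] at hnot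
  have hcross : ∀ n, ∃ r ∈ Set.Icc t s, (ContinuousOn (P n) (Set.Icc t s) ∧ P n t = x ∧
      ¬ |P n (ρ n)| ≤ B) → |P n r| = B := by
    intro n
    by_cases h : ContinuousOn (P n) (Set.Icc t s) ∧ P n t = x ∧ ¬ |P n (ρ n)| ≤ B
    · obtain ⟨h1, h2, h3⟩ := h
      obtain ⟨r, hr, hrB⟩ := intermediate_value_Icc (hρ n).1
        (h1.mono (Set.Icc_subset_Icc_right (hρ n).2)).abs
        (show B ∈ Set.Icc |P n t| |P n (ρ n)| from ⟨h2 ▸ hxB.le, (not_le.1 h3).le⟩)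
      exact ⟨r, ⟨hr.1, hr.2.trans (hρ n).2⟩, fun _ => hrB⟩
    · exact ⟨t, ⟨le_rfl, hts.le⟩, fun h' => absurd h' h⟩
  choose ρ' hρ' hρB using hcross
  have hB : ∀ᶠ n in U, |P n (ρ' n)| = B := by
    filter_upwards [hP, hcont, hnot] with n h1 h2 h3 using hρB n ⟨h2, h1.2.1, h3⟩
  obtain ⟨r, hr, hrlim⟩ := U.exists_tendsto_of_isCompact isCompact_Icc (Eventually.of_forall hρ')
  obtain ⟨z, -, hz⟩ := U.exists_tendsto_of_isCompact (isCompact_Icc (a := -B) (b := B))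
    (g := fun n => P n (ρ' n)) (hB.mono fun n h => abs_le.1 h.le)
  have hzB : |z| = B :=
    tendsto_nhds_unique (hz.abs.congr' hB) tendsto_const_nhds
  rcases hr.1.eq_or_lt with rfl | htr
  · rw [hlim.eq_left hF hf hts hP hρ' hrlim hz] at hzB
    linarith
  rcases hr.2.eq_or_lt with rfl | hrs
  · rw [hlim.eq_right hF hf hts hP hρ' hrlim hz] at hzB
    linarith
  have heq := hlim.add_eq hP htr hrs hrlim hz
  have := hb x t y s rfl r ⟨htr, hrs⟩ z fun w => by
    rw [heq]
    exact hf.1.add_le htr hrs x w y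
  linarith

/-- Additivity passes to limits in which the times at which the paths are evaluated may vary. -/
theorem ConvergesContinuously.isAdditiveAlong [l.NeBot] (hlim : ConvergesContinuously F f l)
    (hts : t < s) (hP : ∀ᶠ n in l, IsAdditiveAlong (F n) (P n) t s)
    {ρ : ℕ → ℝ → ℝ} {τ : ℝ → ℝ} (hρ : ∀ r, Tendsto (fun n => ρ n r) l (𝓝 r))
    (hρt : ∀ n, ρ n t = t) (hρs : ∀ n, ρ n s = s)
    (hτ : ∀ r ∈ Set.Icc t s, Tendsto (fun n => P n (ρ n r)) l (𝓝 (τ r))) :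
    IsAdditiveAlong f τ t s := by
  intro k σ hk h0 hks hσ
  have hmono : ∀ j ≤ k, ∀ i ≤ j, σ i ≤ σ j := by
    intro j
    induction j with
    | zero => intro _ i hi; rw [Nat.le_zero.1 hi]
    | succ j ih =>
      intro hj i hi
      rcases hi.eq_or_lt with rfl | hi
      · rfl
      · exact (ih (by omega) i (by omega)).trans (hσ j (by omega)).le
  have hmem : ∀ i ≤ k, σ i ∈ Set.Icc t s := fun i hi =>
    ⟨h0 ▸ hmono i hi 0 (Nat.zero_le _), hks ▸ hmono k le_rfl i hi⟩
  have h1 : Tendsto (fun n => ∑ i ∈ Finset.range k, F n (P n (ρ n (σ i)), ρ n (σ i),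
      P n (ρ n (σ (i + 1))), ρ n (σ (i + 1)))) l
      (𝓝 (∑ i ∈ Finset.range k, f (τ (σ i), σ i, τ (σ (i + 1)), σ (i + 1)))) := by
    refine tendsto_finsetSum _ fun i hi => ?_
    have hi := Finset.mem_range.1 hi
    exact hlim _ _ _ _ _ _ _ _ (hσ i hi) (hτ _ (hmem i hi.le)) (hρ _) (hτ _ (hmem (i + 1) hi))
      (hρ _)
  have h2 := hlim _ _ _ _ _ _ _ _ hts (hτ t ⟨le_rfl, hts.le⟩) (hρ t) (hτ s ⟨hts.le, le_rfl⟩)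
    (hρ s)
  refine tendsto_nhds_unique (h1.congr' ?_) h2
  have hlt : ∀ᶠ n in l, ∀ i ∈ Finset.range k, ρ n (σ i) < ρ n (σ (i + 1)) := by
    rw [Filter.eventually_all_finset]
    exact fun i hi => (hρ _).eventually_lt (hρ _) (hσ i (Finset.mem_range.1 hi))
  filter_upwards [hP, hlt] with n h3 h4
  rw [hρt, hρs]
  exact h3 k (fun i => ρ n (σ i)) hk (by rw [h0, hρt]) (by rw [hks, hρs])
    fun i hi => h4 i (Finset.mem_range.2 hi)

end Limits

/-- **Convergence of geodesics under landscape convergence.** If landscapes `fseq n`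
converge uniformly on compact subsets of `ℝ⁴↑` to a proper landscape `f`, the geodesic
`π` from `(x, t)` to `(y, s)` in `f` is unique, and for all large `n` the paths
`πseq n` are geodesics from `(x, t)` to `(y, s)` in `fseq n`, then `πseq n → π`
uniformly on `[t, s]`. -/
theorem geodesic_convergence
    (f : ℝ × ℝ × ℝ × ℝ → ℝ) (fseq : ℕ → ℝ × ℝ × ℝ × ℝ → ℝ)
    (hf : IsProperLandscape f) (hfn : ∀ n, IsLandscape (fseq n))
    (hconv : ∀ K : Set (ℝ × ℝ × ℝ × ℝ), K ⊆ R4up → IsCompact K →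
      TendstoUniformlyOn fseq f Filter.atTop K)
    (x t y s : ℝ) (hts : t < s)
    (π : ℝ → ℝ) (hπ : IsGeodesic f π t s) (hπt : π t = x) (hπs : π s = y)
    (huniq : ∀ τ : ℝ → ℝ, IsGeodesic f τ t s → τ t = x → τ s = y →
      Set.EqOn τ π (Set.Icc t s))
    (πseq : ℕ → ℝ → ℝ)
    (hπn : ∀ᶠ n in Filter.atTop,
      IsGeodesic (fseq n) (πseq n) t s ∧ πseq n t = x ∧ πseq n s = y) :
    TendstoUniformlyOn πseq π Filter.atTop (Set.Icc t s) := by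
  rw [Metric.tendstoUniformlyOn_iff]
  by_contra! hbad
  obtain ⟨ε, hε, hfreq⟩ := hbad
  have : NeBot (atTop ⊓ 𝓟 {n | ∃ r ∈ Set.Icc t s, ε ≤ dist (π r) (πseq n r)}) :=
    frequently_iff_neBot.1 hfreq
  obtain ⟨U, hU⟩ := Ultrafilter.exists_le
    (atTop ⊓ 𝓟 {n | ∃ r ∈ Set.Icc t s, ε ≤ dist (π r) (πseq n r)})
  have hUtop : (U : Filter ℕ) ≤ atTop := hU.trans inf_le_left
  have hUbad : ∀ᶠ n in U, ∃ r ∈ Set.Icc t s, ε ≤ dist (π r) (πseq n r) :=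
    le_principal_iff.1 (hU.trans inf_le_right)
  have hlim : ConvergesContinuously fseq f U :=
    convergesContinuously_of_tendstoUniformlyOn hf.2.1 hUtop hconv
  have hne : ∀ᶠ n in U, fseq n (x, t, y, s) ≠ 0 :=
    (hlim _ _ _ _ x t y s hts tendsto_const_nhds tendsto_const_nhds tendsto_const_nhds
      tendsto_const_nhds).eventually_ne (hf.ne_zero_of_unique hts huniq)
  have hP : ∀ᶠ n in U, IsAdditiveAlong (fseq n) (πseq n) t s ∧ πseq n t = x ∧ πseq n s = y := by
    filter_upwards [hUtop hπn, hne] with n h1 h2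
    refine ⟨h1.1.isAdditiveAlong (hfn n) ?_, h1.2⟩
    rwa [h1.2.1, h1.2.2]
  have hcont : ∀ᶠ n in U, ContinuousOn (πseq n) (Set.Icc t s) := by
    filter_upwards [hUtop hπn] with n h using h.1.1
  have hρex : ∀ n, ∃ r ∈ Set.Icc t s, (∃ r ∈ Set.Icc t s, ε ≤ dist (π r) (πseq n r)) →
      ε ≤ dist (π r) (πseq n r) := by
    intro n
    by_cases h : ∃ r ∈ Set.Icc t s, ε ≤ dist (π r) (πseq n r)
    · obtain ⟨r, hr, h'⟩ := h
      exact ⟨r, hr, fun _ => h'⟩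
    · exact ⟨t, ⟨le_rfl, hts.le⟩, fun h' => absurd h' h⟩
  choose ρ hρ hρε using hρex
  obtain ⟨B, hB⟩ := hlim.exists_bound hfn hf hts hP hcont
  have hcpt : ∀ ρ : ℕ → ℝ, (∀ n, ρ n ∈ Set.Icc t s) →
      ∃ z ∈ Set.Icc (-B) B, Tendsto (fun n => πseq n (ρ n)) U (𝓝 z) := fun ρ hρ =>
    U.exists_tendsto_of_isCompact isCompact_Icc ((hB ρ hρ).mono fun n h => abs_le.1 h)
  obtain ⟨r₀, hr₀, hρlim⟩ := U.exists_tendsto_of_isCompact isCompact_Icc (Eventually.of_forall hρ)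
  obtain ⟨z, -, hz⟩ := hcpt ρ hρ
  have hzε : ε ≤ dist (π r₀) z := by
    have h1 : Tendsto (fun n => π (ρ n)) U (𝓝 (π r₀)) :=
      (hπ.1 r₀ hr₀).tendsto.comp (tendsto_nhdsWithin_iff.2 ⟨hρlim, Eventually.of_forall hρ⟩)
    exact ge_of_tendsto (h1.dist hz) (hUbad.mono hρε)
  have hzne : z ≠ π r₀ := fun h => by
    rw [h, dist_self] at hzε
    linarith
  have hr₀t : t ≠ r₀ := by
    rintro rfl
    exact hzne ((hlim.eq_left hfn hf hts hP hρ hρlim hz).trans hπt.symm)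
  have hr₀s : s ≠ r₀ := by
    rintro rfl
    exact hzne ((hlim.eq_right hfn hf hts hP hρ hρlim hz).trans hπs.symm)
  set ρ' : ℕ → ℝ → ℝ := fun n => Function.update id r₀ (ρ n) with hρ'
  have hρ'0 : ∀ n, ρ' n r₀ = ρ n := fun n => by simp [hρ']
  have hρ'ne : ∀ n r, r ≠ r₀ → ρ' n r = r := fun n r h => by simp [hρ', h]
  have hρ'lim : ∀ r, Tendsto (fun n => ρ' n r) U (𝓝 r) := by
    intro r
    by_cases h : r = r₀
    · subst h
      simpa only [hρ'0] using hρlim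
    · simpa only [hρ'ne _ r h] using tendsto_const_nhds
  have hτex : ∀ r, ∃ w, r ∈ Set.Icc t s → |w| ≤ B ∧
      Tendsto (fun n => πseq n (ρ' n r)) U (𝓝 w) := by
    intro r
    by_cases hr : r ∈ Set.Icc t s
    · obtain ⟨w, hw, hw'⟩ := hcpt (fun n => ρ' n r) fun n => by
        by_cases h : r = r₀
        · subst h
          simpa only [hρ'0] using hρ n
        · simpa only [hρ'ne _ r h] using hr
      exact ⟨w, fun _ => ⟨abs_le.2 hw, hw'⟩⟩
    · exact ⟨0, fun h => absurd h hr⟩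
  choose τ hτ using hτex
  have hadd : IsAdditiveAlong f τ t s :=
    hlim.isAdditiveAlong hts (hP.mono fun n h => h.1) hρ'lim (fun n => hρ'ne n t hr₀t)
      (fun n => hρ'ne n s hr₀s) fun r hr => (hτ r hr).2
  have hgeo := hadd.isGeodesic hts (hadd.continuousOn hf fun r hr => (hτ r hr).1)
  have htmem : t ∈ Set.Icc t s := ⟨le_rfl, hts.le⟩
  have hsmem : s ∈ Set.Icc t s := ⟨hts.le, le_rfl⟩
  have hτt : τ t = x := hlim.eq_left hfn hf hts hP (fun _ => htmem) tendsto_const_nhds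
    (by simpa only [hρ'ne _ t hr₀t] using (hτ t htmem).2)
  have hτs : τ s = y := hlim.eq_right hfn hf hts hP (fun _ => hsmem) tendsto_const_nhds
    (by simpa only [hρ'ne _ s hr₀s] using (hτ s hsmem).2)
  refine hzne (Eq.trans ?_ (huniq τ hgeo hτt hτs hr₀))
  exact tendsto_nhds_unique hz (by simpa only [hρ'0] using (hτ r₀ hr₀).2)
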